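/- arXiv:1205.6681 — 6 statements merged into one kernel-verified Lean document; each statement's English description precedes it below -/
import Mathlib

section
/- Let a and b be real numbers with a > b > 0. If the anthyphairesis of a to b is infinite, i.e. r n ≠ 0 for every natural number n, then a and b are incommensurable. (Proposition X.2 of the Elements, proved here without Eudoxus' principle.) -/
open Classical in
/-- The anthyphairetic remainder sequence of `a` to `b`:
`r 0 = a`, `r 1 = b`, and `r (n+2) = 0` if `r (n+1) = 0`, otherwise
`r (n+2) = r n - ⌊r n / r (n+1)⌋ * r (n+1)`. -/
noncomputable def anthRem (a b : ℝ) : ℕ → ℝ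
  | 0 => a
  | 1 => b
  | n + 2 =>
    if anthRem a b (n + 1) = 0 then 0
    else anthRem a b n - (⌊anthRem a b n / anthRem a b (n + 1)⌋ : ℝ) * anthRem a b (n + 1)

/-- Two positive reals are commensurable if they are positive natural multiples
of a common measure `c > 0`. -/
def AreCommensurable (a b : ℝ) : Prop :=
  ∃ c : ℝ, 0 < c ∧ ∃ m n : ℕ, 0 < m ∧ 0 < n ∧ a = (m : ℝ) * c ∧ b = (n : ℝ) * c

/-- A remainder is the fractional part of the preceding quotient times the divisor. -/
theorem anthRem_add_two (a b : ℝ) {n : ℕ} (h : anthRem a b (n + 1) ≠ 0) :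
    anthRem a b (n + 2) =
      Int.fract (anthRem a b n / anthRem a b (n + 1)) * anthRem a b (n + 1) := by
  rw [anthRem, if_neg h, Int.fract, sub_mul, div_mul_cancel₀ _ h]

theorem anthRem_succ_pos {a b : ℝ} (hb : 0 < b) (hinf : ∀ n, anthRem a b n ≠ 0) (n : ℕ) :
    0 < anthRem a b (n + 1) := by
  induction n with
  | zero => simpa [anthRem] using hb
  | succ n ih =>
    refine lt_of_le_of_ne ?_ (hinf _).symm
    rw [anthRem_add_two a b (hinf _)]
    exact mul_nonneg (Int.fract_nonneg _) ih.le

theorem anthRem_add_two_lt {a b : ℝ} {n : ℕ} (h : 0 < anthRem a b (n + 1)) :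
    anthRem a b (n + 2) < anthRem a b (n + 1) := by
  rw [anthRem_add_two a b h.ne']
  exact mul_lt_of_lt_one_left h (Int.fract_lt_one _)

/-- A common measure of `a` and `b` measures every remainder. -/
theorem exists_anthRem_eq_intCast_mul {a b c : ℝ} {p q : ℤ} (ha : a = p * c) (hb : b = q * c)
    (n : ℕ) : ∃ k : ℤ, anthRem a b n = k * c := by
  induction n using Nat.twoStepInduction with
  | zero => exact ⟨p, by rw [anthRem, ha]⟩
  | one => exact ⟨q, by rw [anthRem, hb]⟩
  | more n ih₀ ih₁ =>
    obtain ⟨k, hk⟩ := ih₀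
    obtain ⟨l, hl⟩ := ih₁
    rw [anthRem]
    split_ifs with h
    · exact ⟨0, by simp⟩
    · refine ⟨k - ⌊anthRem a b n / anthRem a b (n + 1)⌋ * l, ?_⟩
      push_cast
      linear_combination hk - (⌊anthRem a b n / anthRem a b (n + 1)⌋ : ℝ) * hl

/-- Proposition X.2 of the Elements: if the anthyphairesis of `a` to `b`
is infinite, then `a` and `b` are incommensurable. -/
theorem incommensurable_of_infinite_anthyphairesis
    (a b : ℝ) (hab : a > b) (hb : b > 0)
    (hinf : ∀ n : ℕ, anthRem a b n ≠ 0) :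
    ¬ AreCommensurable a b := by
  rintro ⟨c, hc, m, n, -, -, hm, hn⟩
  have hpos := anthRem_succ_pos hb hinf
  have hmeas : ∀ i, ∃ k : ℕ, anthRem a b (i + 1) = k * c := fun i => by
    obtain ⟨k, hk⟩ := exists_anthRem_eq_intCast_mul (p := m) (q := n)
      (by exact_mod_cast hm) (by exact_mod_cast hn) (i + 1)
    have hk_pos : (0 : ℝ) < k := pos_of_mul_pos_left (hk ▸ hpos i) hc.le
    lift k to ℕ using by exact_mod_cast hk_pos.le
    exact ⟨k, by exact_mod_cast hk⟩
  choose k hk using hmeas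
  refine not_strictAnti_of_wellFoundedLT k (strictAnti_nat_of_succ_lt fun i => ?_)
  have hlt := anthRem_add_two_lt (hpos i)
  rw [hk (i + 1), hk i] at hlt
  exact_mod_cast lt_of_mul_lt_mul_right hlt hc.le
end

section
/- Let a and b be real numbers with a > b > 0. If a and b are commensurable, then the anthyphairesis of a to b is finite, i.e. r n = 0 for some natural number n. (Statement X.3* of the paper, the contrapositive of Proposition X.2, proved elementarily via the Euclidean algorithm on numbers.) -/
theorem floor_mul_div_mul_eq_natDiv {c : ℝ} (hc : 0 < c) (x y : ℕ) :
    ⌊(x * c : ℝ) / (y * c)⌋ = ((x / y : ℕ) : ℤ) := by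
  rw [mul_div_mul_right _ _ hc.ne', ← Nat.floor_div_eq_div (K := ℝ) x y,
    Int.natCast_floor_eq_floor (by positivity)]

/-- On consecutive remainders that are multiples of `c`, one step of the anthyphairesis
is one step of the Euclidean algorithm on the multipliers. -/
theorem anthRem_add_two_eq_mod_mul {a b c : ℝ} (hc : 0 < c) {k x y : ℕ} (hy : y ≠ 0)
    (hk : anthRem a b k = x * c) (hk_succ : anthRem a b (k + 1) = y * c) :
    anthRem a b (k + 2) = ((x % y : ℕ) : ℝ) * c := by
  have hyc : (y : ℝ) * c ≠ 0 := mul_ne_zero (Nat.cast_ne_zero.mpr hy) hc.ne'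
  have hdiv : (x : ℝ) = y * (x / y : ℕ) + (x % y : ℕ) := by
    exact_mod_cast (Nat.div_add_mod x y).symm
  rw [anthRem, hk, hk_succ, if_neg hyc, floor_mul_div_mul_eq_natDiv hc, Int.cast_natCast]
  linear_combination c * hdiv

theorem exists_anthRem_eq_zero_of_eq_natCast_mul {a b c : ℝ} (hc : 0 < c) (y : ℕ) :
    ∀ k x : ℕ, anthRem a b k = x * c → anthRem a b (k + 1) = y * c →
      ∃ n : ℕ, anthRem a b n = 0 := by
  induction y using Nat.strong_induction_on with
  | _ y ih =>
    intro k x hk hk_succ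
    rcases Nat.eq_zero_or_pos y with rfl | hy
    · exact ⟨k + 1, by simpa using hk_succ⟩
    · exact ih (x % y) (Nat.mod_lt x hy) (k + 1) y hk_succ
        (anthRem_add_two_eq_mod_mul hc hy.ne' hk hk_succ)

/-- Statement X.3* of the paper (contrapositive of Proposition X.2): if `a` and `b`
are commensurable, then the anthyphairesis of `a` to `b` is finite. -/
theorem finite_anthyphairesis_of_commensurable
    (a b : ℝ) (hab : a > b) (hb : b > 0)
    (hcomm : AreCommensurable a b) :
    ∃ n : ℕ, anthRem a b n = 0 := by
  obtain ⟨c, hc, m, n, -, -, ha, hbc⟩ := hcomm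
  exact exists_anthRem_eq_zero_of_eq_natCast_mul hc n 0 m
    (by rw [anthRem, ha]) (by rw [zero_add, anthRem, hbc])
end

section
/- Let a and b be real numbers with a > b > 0. If a and b are incommensurable, then the anthyphairesis of a to b is infinite, i.e. r n ≠ 0 for every natural number n. (The Converse of Proposition X.2, valid for real magnitudes, which satisfy Eudoxus' (Archimedean) principle.) -/
/-- A positive natural multiple of a positive real is commensurable with it. -/
theorem AreCommensurable.natCast_mul_self {y : ℝ} (hy : 0 < y) {k : ℕ} (hk : 0 < k) :
    AreCommensurable (k * y) y :=
  ⟨y, hy, k, 1, hk, one_pos, rfl, by simp⟩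

/-- If `y` and `z` are commensurable, then so are `z + k * y` and `y`. -/
theorem AreCommensurable.add_natCast_mul {y z : ℝ} (h : AreCommensurable y z) (k : ℕ) :
    AreCommensurable (z + k * y) y := by
  obtain ⟨c, hc, m, n, hm, hn, rfl, rfl⟩ := h
  exact ⟨c, hc, n + k * m, m, by positivity, hm, by push_cast; ring, rfl⟩

/-- Subtracting the integer part preserves positivity and incommensurability. -/
theorem pos_and_not_areCommensurable_sub_floor_mul {x y : ℝ} (hx : 0 < x) (hy : 0 < y)
    (h : ¬ AreCommensurable x y) :
    0 < x - (⌊x / y⌋ : ℝ) * y ∧ ¬ AreCommensurable y (x - (⌊x / y⌋ : ℝ) * y) := by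
  rw [← natCast_floor_eq_intCast_floor (div_pos hx hy).le]
  set k := ⌊x / y⌋₊
  have hk : (k : ℝ) * y ≤ x := (le_div_iff₀ hy).1 (Nat.floor_le (div_pos hx hy).le)
  refine ⟨sub_pos.2 (hk.lt_of_ne fun he => h ?_), fun hc => h ?_⟩
  · have hk0 : 0 < k := Nat.pos_of_ne_zero fun h0 => by simp [h0] at he; exact hx.ne he
    exact he ▸ AreCommensurable.natCast_mul_self hy hk0
  · simpa using hc.add_natCast_mul k

/-- Consecutive remainders of incommensurable positive reals are positive and incommensurable. -/
theorem anthRem_pos_and_not_areCommensurable {a b : ℝ} (ha : 0 < a) (hb : 0 < b)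
    (h : ¬ AreCommensurable a b) (n : ℕ) :
    0 < anthRem a b n ∧ 0 < anthRem a b (n + 1) ∧
      ¬ AreCommensurable (anthRem a b n) (anthRem a b (n + 1)) := by
  induction n with
  | zero => simpa [anthRem] using ⟨ha, hb, h⟩
  | succ n ih =>
    obtain ⟨hx, hy, hxy⟩ := ih
    rw [anthRem, if_neg hy.ne']
    exact ⟨hy, pos_and_not_areCommensurable_sub_floor_mul hx hy hxy⟩

/-- The converse of Proposition X.2 (valid for real magnitudes, which satisfy
Eudoxus' (Archimedean) principle): if `a` and `b` are incommensurable, then the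
anthyphairesis of `a` to `b` is infinite. -/
theorem infinite_anthyphairesis_of_incommensurable
    (a b : ℝ) (hab : a > b) (hb : b > 0)
    (hincomm : ¬ AreCommensurable a b) :
    ∀ n : ℕ, anthRem a b n ≠ 0 := by
  intro n
  exact (anthRem_pos_and_not_areCommensurable (hb.trans hab) hb hincomm n).1.ne'
end

section
/- Let m and n be natural numbers with m > n > 0 and let c > 0 be a real number. Then for every natural number k, the k-th anthyphairetic remainder of the reals m·c to n·c equals c times the k-th Euclidean remainder of m to n, i.e. Anth(m·c, n·c) = Anth(m, n); in particular, the anthyphairesis of m·c to n·c is finite. (The key lemma (**) of the paper's Alternative proof of Proposition X.2, requiring no use of Eudoxus' principle.) -/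
/-- The Euclidean remainder sequence of natural numbers `m` to `n`:
`s 0 = m`, `s 1 = n`, and `s (k+2) = 0` if `s (k+1) = 0`, otherwise
`s (k+2) = s k % s (k+1)`. -/
def eucRem (m n : ℕ) : ℕ → ℕ
  | 0 => m
  | 1 => n
  | k + 2 =>
    if eucRem m n (k + 1) = 0 then 0
    else eucRem m n k % eucRem m n (k + 1)

theorem floor_mul_natCast_div_mul_natCast {c : ℝ} (hc : c ≠ 0) (a b : ℕ) :
    ⌊c * (a : ℝ) / (c * (b : ℝ))⌋ = ((a / b : ℕ) : ℤ) := by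
  rw [mul_div_mul_left _ _ hc, Int.floor_div_natCast, Int.floor_natCast, Int.natCast_div]

theorem anthRem_natCast_mul (m n : ℕ) {c : ℝ} (hc : c ≠ 0) (k : ℕ) :
    anthRem ((m : ℝ) * c) ((n : ℝ) * c) k = c * (eucRem m n k : ℝ) := by
  induction k using Nat.twoStepInduction with
  | zero => simp [anthRem, eucRem, mul_comm]
  | one => simp [anthRem, eucRem, mul_comm]
  | more k ih₀ ih₁ =>
    rw [anthRem, eucRem, ih₀, ih₁]
    by_cases h : eucRem m n (k + 1) = 0
    · simp [h]
    · have hcast : c * (eucRem m n (k + 1) : ℝ) ≠ 0 := mul_ne_zero hc (Nat.cast_ne_zero.mpr h)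
      rw [if_neg hcast, if_neg h, floor_mul_natCast_div_mul_natCast hc, Int.cast_natCast]
      have hdiv : ((eucRem m n k % eucRem m n (k + 1) : ℕ) : ℝ) +
          (eucRem m n (k + 1) : ℝ) * ((eucRem m n k / eucRem m n (k + 1) : ℕ) : ℝ) =
          (eucRem m n k : ℝ) := by
        exact_mod_cast Nat.mod_add_div (eucRem m n k) (eucRem m n (k + 1))
      linear_combination (-c) * hdiv

theorem eucRem_succ_add_le (m n k : ℕ) (h : eucRem m n (k + 1) ≠ 0) :
    eucRem m n (k + 1) + k ≤ n := by
  induction k with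
  | zero => simp [eucRem]
  | succ k ih =>
    have h₁ : eucRem m n (k + 1) ≠ 0 := fun h₀ => h (by simp [eucRem, h₀])
    have hlt : eucRem m n (k + 1 + 1) < eucRem m n (k + 1) := by
      rw [eucRem, if_neg h₁]
      exact Nat.mod_lt _ (Nat.pos_of_ne_zero h₁)
    have := ih h₁
    omega

theorem eucRem_succ_self_eq_zero (m n : ℕ) : eucRem m n (n + 1) = 0 := by
  by_contra h
  have := eucRem_succ_add_le m n n h
  omega

/-- The key lemma (**) of the paper's Alternative proof of Proposition X.2:
the anthyphairesis of `m·c` to `n·c` is, term by term, `c` times the Euclidean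
algorithm on `m` and `n`; in particular it is finite. -/
theorem anthRem_natMul_eq_mul_eucRem
    (m n : ℕ) (hmn : m > n) (hn : n > 0) (c : ℝ) (hc : c > 0) :
    (∀ k : ℕ, anthRem ((m : ℝ) * c) ((n : ℝ) * c) k = c * (eucRem m n k : ℝ)) ∧
    (∀ k : ℕ, eucRem m n (k + 1) ≠ 0 →
      ⌊anthRem ((m : ℝ) * c) ((n : ℝ) * c) k / anthRem ((m : ℝ) * c) ((n : ℝ) * c) (k + 1)⌋ =
        (eucRem m n k / eucRem m n (k + 1) : ℕ)) ∧
    (∃ k : ℕ, anthRem ((m : ℝ) * c) ((n : ℝ) * c) k = 0) := by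
  refine ⟨anthRem_natCast_mul m n hc.ne', fun k _ => ?_, n + 1, ?_⟩
  · rw [anthRem_natCast_mul m n hc.ne', anthRem_natCast_mul m n hc.ne',
      floor_mul_natCast_div_mul_natCast hc.ne']
  · rw [anthRem_natCast_mul m n hc.ne', eucRem_succ_self_eq_zero, Nat.cast_zero, mul_zero]
end

section
/- Let a > 0 be a real number and let C be the set of all real numbers of the form (m·a)/n where m and n range over the positive natural numbers. Then (i) every pair of elements of C is a commensurable pair, but (ii) there is no common unit for C: there is no real c > 0 such that every element x of C satisfies x = k·c for some natural number k. (The counterexample of Section 2.1 refuting the claim that absence of a common unit implies incommensurability.) -/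
/-- The counterexample of Section 2.1: for `a > 0`, the class
`C = { (m·a)/n : m, n positive naturals }` consists of pairwise commensurable
elements, yet it has no common unit. -/
theorem pairwise_commensurable_class_without_common_unit
    (a : ℝ) (ha : 0 < a) :
    (∀ x ∈ {x : ℝ | ∃ m n : ℕ, 0 < m ∧ 0 < n ∧ x = (m : ℝ) * a / (n : ℝ)},
      ∀ y ∈ {x : ℝ | ∃ m n : ℕ, 0 < m ∧ 0 < n ∧ x = (m : ℝ) * a / (n : ℝ)},
        AreCommensurable x y) ∧
    ¬ ∃ c : ℝ, 0 < c ∧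
        ∀ x ∈ {x : ℝ | ∃ m n : ℕ, 0 < m ∧ 0 < n ∧ x = (m : ℝ) * a / (n : ℝ)},
          ∃ k : ℕ, x = (k : ℝ) * c := by
  constructor
  · rintro x ⟨m, n, hm, hn, rfl⟩ y ⟨p, q, hp, hq, rfl⟩
    have hn' : (0 : ℝ) < n := Nat.cast_pos.mpr hn
    have hq' : (0 : ℝ) < q := Nat.cast_pos.mpr hq
    refine ⟨a / (n * q), by positivity, m * q, p * n, Nat.mul_pos hm hq, Nat.mul_pos hp hn, ?_, ?_⟩
    · push_cast
      field_simp
    · push_cast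
      field_simp
  · rintro ⟨c, hc, h⟩
    obtain ⟨k, hk⟩ := h a ⟨1, 1, one_pos, one_pos, by simp⟩
    obtain ⟨l, hl⟩ := h (a / (k + 1)) ⟨1, k + 1, one_pos, k.succ_pos, by simp⟩
    have hk_pos : k ≠ 0 := by
      rintro rfl
      simp [hk] at ha
    have hkl : (k : ℝ) = l * (k + 1) := by
      rw [div_eq_iff (by positivity)] at hl
      apply mul_right_cancel₀ hc.ne'
      linarith
    have hkl_nat : k = l * (k + 1) := by exact_mod_cast hkl
    have hdvd : k + 1 ∣ k := ⟨l, by rw [mul_comm]; exact hkl_nat⟩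
    exact absurd (Nat.le_of_dvd (Nat.pos_of_ne_zero hk_pos) hdvd) (by omega)
end

section
/- Let C be a natural number that is not a perfect square. Then the quotient sequence q n = ⌊r n / r (n+1)⌋ of the anthyphairesis of √C to 1 is eventually periodic: there exist a natural number N and a natural number p > 0 such that q (n + p) = q n for all n ≥ N. (Part (ii) of the Proposition attributed to Theaetetus and his companion: the anthyphairesis of every power to the one-foot line is periodic; equivalently, the continued fraction of a quadratic surd √C is eventually periodic.) -/
/-- The complete quotients of an anthyphairesis are obtained by iterating the Gauss map. -/
theorem anthRem_div_succ (a b : ℝ) (n : ℕ) :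
    anthRem a b (n + 1) / anthRem a b (n + 2) =
      (Int.fract (anthRem a b n / anthRem a b (n + 1)))⁻¹ := by
  rw [anthRem]
  split_ifs with h
  · simp [h]
  · rw [← inv_div, Int.fract, sub_div, mul_div_cancel_right₀ _ h]

/-- The numbers `(P + √C) / Q` with `P`, `Q` integers, `Q ∣ C - P ^ 2`, which exceed `1` and have
a negative conjugate. -/
def quadraticQuotients (C : ℕ) : Set ℝ :=
  {x | ∃ P Q : ℤ, 0 < Q ∧ Q ∣ (C : ℤ) - P ^ 2 ∧ (P : ℝ) < √(C : ℝ) ∧ (Q : ℝ) < P + √(C : ℝ) ∧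
    x = (P + √(C : ℝ)) / Q}

theorem finite_quadraticQuotients (C : ℕ) : (quadraticQuotients C).Finite := by
  refine ((((Set.finite_Icc (-(C : ℤ)) C).prod (Set.finite_Icc 0 (2 * (C : ℤ))))).image
    fun z : ℤ × ℤ ↦ ((z.1 : ℝ) + √(C : ℝ)) / z.2).subset ?_
  rintro x ⟨P, Q, hQ, -, hP, hQP, rfl⟩
  have hs : √(C : ℝ) ≤ C := by
    rw [Real.sqrt_le_left (Nat.cast_nonneg C)]
    exact_mod_cast Nat.le_self_pow two_ne_zero C
  have hQ' : (0 : ℝ) < Q := by exact_mod_cast hQ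
  refine ⟨(P, Q), ⟨⟨?_, ?_⟩, ⟨hQ.le, ?_⟩⟩, rfl⟩
  · have : -(C : ℝ) ≤ P := by linarith
    exact_mod_cast this
  · have : (P : ℝ) ≤ C := by linarith
    exact_mod_cast this
  · have : (Q : ℝ) ≤ 2 * C := by linarith
    exact_mod_cast this

theorem sqrt_mem_quadraticQuotients {C : ℕ} (hC : 1 < C) :
    √(C : ℝ) ∈ quadraticQuotients C := by
  have h : (1 : ℝ) < √(C : ℝ) := by
    rw [Real.lt_sqrt zero_le_one]
    exact_mod_cast (by simpa using hC)
  exact ⟨0, 1, one_pos, one_dvd _, by push_cast; linarith, by push_cast; linarith, by simp⟩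

theorem inv_fract_mem_quadraticQuotients {C : ℕ} (hC : Irrational √(C : ℝ)) {x : ℝ}
    (hx : x ∈ quadraticQuotients C) : (Int.fract x)⁻¹ ∈ quadraticQuotients C := by
  obtain ⟨P, Q, hQ, ⟨k, hk⟩, hP, hQP, hx⟩ := hx
  have hQ' : (0 : ℝ) < Q := by exact_mod_cast hQ
  have hs : √(C : ℝ) ^ 2 = C := Real.sq_sqrt (Nat.cast_nonneg C)
  set s := √(C : ℝ)
  have hfloor : (1 : ℝ) ≤ ⌊x⌋ := by
    have : (1 : ℤ) ≤ ⌊x⌋ := by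
      rw [Int.le_floor, hx, Int.cast_one, one_le_div hQ']
      exact hQP.le
    exact_mod_cast this
  set a := ⌊x⌋
  obtain ⟨P', hP'⟩ : ∃ P' : ℤ, P' = a * Q - P := ⟨_, rfl⟩
  obtain ⟨Q', hQ'Q⟩ : ∃ Q' : ℤ, (C : ℤ) - P' ^ 2 = Q * Q' :=
    ⟨k - a ^ 2 * Q + 2 * a * P, by rw [hP']; linear_combination hk⟩
  have hP'r : (P' : ℝ) = a * Q - P := by exact_mod_cast hP'
  have hQ'r : (s - P') * (s + P') = Q * Q' := by
    have : (C : ℝ) - (P' : ℝ) ^ 2 = Q * Q' := by exact_mod_cast hQ'Q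
    linear_combination this + hs
  have hfract : Int.fract x * Q = s - P' := by
    have : x * Q = P + s := by rw [hx, div_mul_cancel₀ _ hQ'.ne']
    rw [Int.fract, hP'r]
    linear_combination this
  have hlt : s - P' < Q := by nlinarith [Int.fract_lt_one x]
  have hpos : 0 < s - P' := by
    refine lt_of_le_of_ne (hfract ▸ mul_nonneg (Int.fract_nonneg x) hQ'.le) fun h ↦ ?_
    exact hC.ne_int P' (by linarith)
  have hadd : 0 < s + P' := by nlinarith
  have hQ'pos : (0 : ℝ) < Q' := pos_of_mul_pos_right (hQ'r ▸ mul_pos hpos hadd) hQ'.le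
  refine ⟨P', Q', by exact_mod_cast hQ'pos, ⟨Q, by rw [hQ'Q, mul_comm]⟩, by linarith, ?_, ?_⟩
  · nlinarith
  · rw [eq_div_iff hQ'pos.ne', inv_mul_eq_iff_eq_mul₀]
    · apply mul_left_cancel₀ hQ'.ne'
      linear_combination -hQ'r - (s + P') * hfract
    · rintro h
      rw [h, zero_mul] at hfract
      exact hpos.ne hfract

/-- An orbit that stays in a finite set is eventually periodic. -/
theorem exists_eventually_periodic_of_mem_finite {α : Type*} {S : Set α} (hS : S.Finite)
    {f : α → α} {u : ℕ → α} (hu : ∀ n, u (n + 1) = f (u n)) (hmem : ∀ n, u n ∈ S) :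
    ∃ N p : ℕ, 0 < p ∧ ∀ n, N ≤ n → u (n + p) = u n := by
  obtain ⟨i, -, j, -, hij, h⟩ :=
    Set.infinite_univ.exists_lt_map_eq_of_mapsTo (f := u) (fun n _ ↦ hmem n) hS
  refine ⟨i, j - i, Nat.sub_pos_of_lt hij, fun n hn ↦ ?_⟩
  induction n, hn using Nat.le_induction with
  | base => rw [Nat.add_sub_cancel' hij.le, h]
  | succ n _ ih => rw [Nat.add_right_comm, hu, hu, ih]

/-- Part (ii) of the Proposition attributed to Theaetetus and his companion: for a
non-square natural number `C`, the quotient sequence `q n = ⌊r n / r (n+1)⌋` of the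
anthyphairesis of `√C` to `1` is eventually periodic. -/
theorem anthyphairesis_sqrt_eventually_periodic
    (C : ℕ) (hC : ¬ ∃ k : ℕ, C = k ^ 2) :
    ∃ N : ℕ, ∃ p : ℕ, 0 < p ∧ ∀ n : ℕ, N ≤ n →
      ⌊anthRem (Real.sqrt (C : ℝ)) 1 (n + p) / anthRem (Real.sqrt (C : ℝ)) 1 (n + p + 1)⌋ =
        ⌊anthRem (Real.sqrt (C : ℝ)) 1 n / anthRem (Real.sqrt (C : ℝ)) 1 (n + 1)⌋ := by
  have hirr : Irrational √(C : ℝ) := by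
    rw [irrational_sqrt_natCast_iff]
    rintro ⟨k, hk⟩
    exact hC ⟨k, by rw [hk, sq]⟩
  have hC1 : 1 < C := by
    by_contra! h
    interval_cases C
    · exact hC ⟨0, rfl⟩
    · exact hC ⟨1, rfl⟩
  have hmem (n : ℕ) : anthRem √(C : ℝ) 1 n / anthRem √(C : ℝ) 1 (n + 1) ∈
      quadraticQuotients C := by
    induction n with
    | zero => simpa [anthRem] using sqrt_mem_quadraticQuotients hC1
    | succ n ih =>
      rw [anthRem_div_succ]
      exact inv_fract_mem_quadraticQuotients hirr ih
  obtain ⟨N, p, hp, h⟩ := exists_eventually_periodic_of_mem_finite (finite_quadraticQuotients C)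
    (f := fun x ↦ (Int.fract x)⁻¹) (anthRem_div_succ √(C : ℝ) 1) hmem
  exact ⟨N, p, hp, fun n hn ↦ congrArg Int.floor (h n hn)⟩
end
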